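/- arXiv:2512.20562 — 2 statements merged into one kernel-verified Lean document; each statement's English description precedes it below -/
import Mathlib

section
/- Let (X, μ) be a probability space and Y₀, …, Y_{M−1} : X → ℝ measurable functions orthonormal in L²(μ), i.e. ∫ Y_i Y_j dμ = 1 if i = j and 0 otherwise. Let A = {i₁ < … < i_{r₁}} and B = {j₁ < … < j_{r₂}} be nonempty subsets of {0,…,M−1}, and suppose there are constants c_A, c_B ∈ [1, M] such that Σ_{j∈A} Y_j(w)² = c_A and Σ_{j∈B} Y_j(w)² = c_B for every w ∈ X. Let w₁, …, w_m be i.i.d. samples from μ, and define the matrices 𝐀 ∈ ℝ^{r₁×m} with 𝐀_{s,r} = Y_{i_s}(w_r) and 𝐁 ∈ ℝ^{r₂×m} with 𝐁_{t,r} = Y_{j_t}(w_r), and let Ē ∈ ℝ^{r₁×r₂} be the matrix with Ē_{s,t} = 1 if i_s = j_t and 0 otherwise (so that Ē = E[(1/m)𝐀𝐁ᵀ]). Then for every δ ∈ (0,1), if m ≥ 4 M log(2M/δ), with probability at least 1 − δ the spectral norm satisfies ‖(1/m)𝐀𝐁ᵀ − Ē‖₂ ≤ √(4 M log(2M/δ)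 / m). -/
open MeasureTheory Matrix

/-- The spectral (ℓ²-operator) norm of a real matrix. -/
noncomputable def specNorm {m n : Type*} [Fintype m] [Fintype n] [DecidableEq n]
    (A : Matrix m n ℝ) : ℝ :=
  ‖LinearMap.toContinuousLinearMap (Matrix.toEuclideanLin A)‖

section

open Filter Topology NormedSpace

theorem norm_exp_le_exp_norm_of_normOneClass {𝔸 : Type*} [NormedRing 𝔸]
    [NormedAlgebra ℝ 𝔸] [NormOneClass 𝔸] (a : 𝔸) : ‖exp a‖ ≤ Real.exp ‖a‖ := by
  rw [exp_eq_tsum (𝕂 := ℝ), Real.exp_eq_exp_ℝ, exp_eq_tsum (𝕂 := ℝ)]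
  refine tsum_of_norm_bounded (expSeries_summable' (𝕂 := ℝ) ‖a‖).hasSum fun k => ?_
  rw [norm_smul, smul_eq_mul, Real.norm_of_nonneg (by positivity)]
  gcongr
  exact norm_pow_le a k

theorem norm_pow_sub_pow_le {𝔸 : Type*} [NormedRing 𝔸] [NormOneClass 𝔸] {x y : 𝔸} {C : ℝ}
    (hC : 0 ≤ C) (hx : ‖x‖ ≤ C) (hy : ‖y‖ ≤ C) (k : ℕ) :
    ‖x ^ (k + 1) - y ^ (k + 1)‖ ≤ (k + 1) * C ^ k * ‖x - y‖ := by
  induction k with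
  | zero => simp
  | succ k ih =>
    have h : x ^ (k + 1 + 1) - y ^ (k + 1 + 1)
        = x * (x ^ (k + 1) - y ^ (k + 1)) + (x - y) * y ^ (k + 1) := by
      rw [pow_succ' x, pow_succ' y (k + 1)]; noncomm_ring
    rw [h]
    calc _ ≤ ‖x‖ * ‖x ^ (k + 1) - y ^ (k + 1)‖ + ‖x - y‖ * ‖y‖ ^ (k + 1) := by
          refine (norm_add_le _ _).trans (add_le_add (norm_mul_le _ _) ?_)
          exact (norm_mul_le _ _).trans (by gcongr; exact norm_pow_le _ _)
      _ ≤ C * ((k + 1) * C ^ k * ‖x - y‖) + ‖x - y‖ * C ^ (k + 1) := by gcongr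
      _ = _ := by push_cast; ring

/-- The Lie–Trotter product formula. -/
theorem tendsto_exp_mul_exp_pow {𝔸 : Type*} [NormedRing 𝔸] [NormedAlgebra ℝ 𝔸] [NormOneClass 𝔸]
    [CompleteSpace 𝔸] (a b : 𝔸) :
    Tendsto (fun k : ℕ => (exp (((k : ℝ) + 1)⁻¹ • a) * exp (((k : ℝ) + 1)⁻¹ • b)) ^ (k + 1))
      atTop (𝓝 (exp (a + b))) := by
  set f : ℝ → 𝔸 := fun t => exp (t • a) * exp (t • b) - exp (t • (a + b)) with hf
  have hd : HasDerivAt f 0 0 := by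
    have h : HasDerivAt f _ 0 := ((hasDerivAt_exp_smul_const (𝕂 := ℝ) a (0 : ℝ)).mul
      (hasDerivAt_exp_smul_const (𝕂 := ℝ) b (0 : ℝ))).sub
      (hasDerivAt_exp_smul_const (𝕂 := ℝ) (a + b) (0 : ℝ))
    exact h.congr_deriv (by simp)
  have ht : Tendsto (fun k : ℕ => ((k : ℝ) + 1)⁻¹) atTop (𝓝 0) := by
    simpa using tendsto_one_div_add_atTop_nhds_zero_nat (𝕜 := ℝ)
  have hf0 : f 0 = 0 := by simp [hf]
  have ho : (fun k : ℕ => ‖f ((k : ℝ) + 1)⁻¹‖) =o[atTop] fun k : ℕ => ((k : ℝ) + 1)⁻¹ := by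
    have := ((hasDerivAt_iff_isLittleO_nhds_zero.1 hd).comp_tendsto ht).norm_left
    simpa [Function.comp_def, hf0] using this
  have ho' : Tendsto (fun k : ℕ => ((k : ℝ) + 1) * ‖f ((k : ℝ) + 1)⁻¹‖) atTop (𝓝 0) := by
    refine ho.tendsto_div_nhds_zero.congr fun k => ?_
    rw [div_inv_eq_mul, mul_comm]
  rw [tendsto_iff_norm_sub_tendsto_zero]
  have hb := (ho'.const_mul (Real.exp (‖a‖ + ‖b‖)))
  rw [mul_zero] at hb
  refine squeeze_zero (fun _ => norm_nonneg _) (fun k => ?_) hb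
  set s : ℝ := ((k : ℝ) + 1)⁻¹ with hs
  have hspos : 0 < s := by positivity
  have hk : ((k : ℝ) + 1) * s = 1 := by rw [hs]; field_simp
  have hpow : exp (a + b) = exp (s • (a + b)) ^ (k + 1) := by
    let _ : NormedAlgebra ℚ 𝔸 := NormedAlgebra.restrictScalars ℚ ℝ 𝔸
    rw [← NormedSpace.exp_nsmul, ← Nat.cast_smul_eq_nsmul ℝ, smul_smul]
    push_cast
    rw [hk, one_smul]
  set C := Real.exp (s * (‖a‖ + ‖b‖)) with hC
  have h1 : ‖exp (s • a) * exp (s • b)‖ ≤ C := by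
    refine (norm_mul_le _ _).trans ?_
    rw [hC, mul_add, Real.exp_add]
    gcongr
    · simpa [norm_smul, abs_of_pos hspos] using norm_exp_le_exp_norm_of_normOneClass (s • a)
    · simpa [norm_smul, abs_of_pos hspos] using norm_exp_le_exp_norm_of_normOneClass (s • b)
  have h2 : ‖exp (s • (a + b))‖ ≤ C := by
    refine (norm_exp_le_exp_norm_of_normOneClass _).trans ?_
    rw [norm_smul, Real.norm_of_nonneg hspos.le]
    exact Real.exp_le_exp.2 (by gcongr; exact norm_add_le a b)
  rw [hpow]
  refine (norm_pow_sub_pow_le (Real.exp_pos _).le h1 h2 k).trans ?_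
  have hCk : C ^ k ≤ Real.exp (‖a‖ + ‖b‖) := by
    rw [hC, ← Real.exp_nat_mul]
    refine Real.exp_le_exp.2 ?_
    have : (k : ℝ) * s ≤ 1 := by nlinarith
    rw [← mul_assoc]
    exact mul_le_of_le_one_left (by positivity) this
  calc _ = C ^ k * (((k : ℝ) + 1) * ‖f s‖) := by simp only [hf]; ring
    _ ≤ _ := by gcongr

theorem trace_mul_pow_comm {n : Type*} [Fintype n] [DecidableEq n] (A B : Matrix n n ℝ) (k : ℕ) :
    trace ((A * B) ^ k) = trace ((B * A) ^ k) := by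
  cases k with
  | zero => simp
  | succ k =>
    rw [pow_succ, ← mul_assoc, mul_pow_mul, mul_assoc, trace_mul_comm, mul_assoc, ← pow_succ]

theorem trace_mul_transpose_self_nonneg {n : Type*} [Fintype n] (A : Matrix n n ℝ) :
    0 ≤ trace (A * Aᵀ) := by
  simpa using (posSemidef_self_mul_conjTranspose A).trace_nonneg

theorem two_mul_trace_mul_le {n : Type*} [Fintype n] (A B : Matrix n n ℝ) :
    2 * trace (A * B) ≤ trace (A * Aᵀ) + trace (Bᵀ * B) := by
  have h := trace_mul_transpose_self_nonneg (A - Bᵀ)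
  have e : trace (Bᵀ * Aᵀ) = trace (A * B) := by rw [← transpose_mul, trace_transpose]
  simp only [transpose_sub, transpose_transpose, sub_mul, mul_sub, trace_sub, e] at h
  linarith

/-- If the trace inequality `|tr Xᵖ| ≤ tr (X Xᵀ)^(p/2)` holds for smaller powers of two `p`, then
`tr (P Q)ᵖ ≤ tr (Pᵖ Qᵖ)` for symmetric `P`, `Q`. -/
theorem trace_mul_pow_two_pow_le_of {n : Type*} [Fintype n] [DecidableEq n] (j : ℕ)
    (h : ∀ i < j, ∀ X : Matrix n n ℝ, |trace (X ^ 2 ^ (i + 1))| ≤ trace ((X * Xᵀ) ^ 2 ^ i)) :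
    ∀ P Q : Matrix n n ℝ, P.IsSymm → Q.IsSymm →
      trace ((P * Q) ^ 2 ^ j) ≤ trace (P ^ 2 ^ j * Q ^ 2 ^ j) := by
  induction j with
  | zero => intro P Q _ _; simp
  | succ j ih =>
    intro P Q hP hQ
    calc trace ((P * Q) ^ 2 ^ (j + 1)) ≤ trace ((P * Q * (P * Q)ᵀ) ^ 2 ^ j) :=
          (le_abs_self _).trans (h j (Nat.lt_succ_self j) _)
      _ = trace ((P * (Q * Q * P)) ^ 2 ^ j) := by
          rw [transpose_mul, hP.eq, hQ.eq]; simp only [mul_assoc]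
      _ = trace ((P ^ 2 * Q ^ 2) ^ 2 ^ j) := by
          rw [trace_mul_pow_comm, mul_assoc (Q * Q), trace_mul_pow_comm, sq, sq]
      _ ≤ trace ((P ^ 2) ^ 2 ^ j * (Q ^ 2) ^ 2 ^ j) :=
          ih (fun i hi => h i (hi.trans (Nat.lt_succ_self j))) _ _ (hP.pow 2) (hQ.pow 2)
      _ = _ := by rw [← pow_mul, ← pow_mul, ← pow_succ']

theorem abs_trace_pow_two_pow_le {n : Type*} [Fintype n] [DecidableEq n] (k : ℕ) :
    ∀ X : Matrix n n ℝ, |trace (X ^ 2 ^ (k + 1))| ≤ trace ((X * Xᵀ) ^ 2 ^ k) := by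
  induction k using Nat.strong_induction_on with
  | _ k ih =>
    intro X
    cases k with
    | zero =>
      have h1 := two_mul_trace_mul_le X X
      have h2 := two_mul_trace_mul_le X (-X)
      have e : trace (Xᵀ * X) = trace (X * Xᵀ) := trace_mul_comm _ _
      simp only [transpose_neg, mul_neg, neg_mul, neg_neg, trace_neg, e] at h1 h2
      rw [zero_add, pow_one, pow_zero, pow_one, sq, abs_le]
      constructor <;> linarith
    | succ k =>
      have h1 := ih k (Nat.lt_succ_self k) (X ^ 2)
      rw [← pow_mul, ← pow_succ'] at h1
      refine h1.trans ?_
      have hQ : (X * Xᵀ).IsSymm := isSymm_mul_transpose_self X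
      have hP : (Xᵀ * X).IsSymm := isSymm_transpose_mul_self X
      have e1 : trace ((X ^ 2 * (X ^ 2)ᵀ) ^ 2 ^ k) = trace ((X * Xᵀ * (Xᵀ * X)) ^ 2 ^ k) := by
        rw [transpose_pow, sq, sq, mul_assoc, trace_mul_pow_comm]
        simp only [mul_assoc]
      rw [e1]
      refine (trace_mul_pow_two_pow_le_of k
        (fun i hi => ih i (hi.trans (Nat.lt_succ_self k))) _ _ hQ hP).trans ?_
      have h2 := two_mul_trace_mul_le ((X * Xᵀ) ^ 2 ^ k) ((Xᵀ * X) ^ 2 ^ k)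
      rw [(hQ.pow _).eq, (hP.pow _).eq, ← pow_add, ← pow_add, ← two_mul, ← pow_succ',
        trace_mul_pow_comm Xᵀ X] at h2
      linarith

/-- The **Golden–Thompson inequality** for real symmetric matrices. -/
theorem trace_exp_add_le {n : Type*} [Fintype n] [DecidableEq n] {A B : Matrix n n ℝ}
    (hA : A.IsSymm) (hB : B.IsSymm) : trace (exp (A + B)) ≤ trace (exp A * exp B) := by
  cases isEmpty_or_nonempty n
  · simp [trace]
  let _ : NormedRing (Matrix n n ℝ) := Matrix.linftyOpNormedRing
  let _ : NormedAlgebra ℝ (Matrix n n ℝ) := Matrix.linftyOpNormedAlgebra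
  have _ : NormOneClass (Matrix n n ℝ) := Matrix.linfty_opNormOneClass
  have hk : Tendsto (fun k : ℕ => 2 ^ k - 1) atTop atTop :=
    (tendsto_sub_atTop_nat 1).comp (tendsto_pow_atTop_atTop_of_one_lt one_lt_two)
  have ht := (continuous_id.matrix_trace.tendsto _).comp
    ((tendsto_exp_mul_exp_pow A B).comp hk)
  refine le_of_tendsto ht (Eventually.of_forall fun k => ?_)
  have hp : 2 ^ k - 1 + 1 = 2 ^ k := Nat.sub_add_cancel Nat.one_le_two_pow
  have hc : ((2 ^ k - 1 : ℕ) : ℝ) + 1 = ((2 ^ k : ℕ) : ℝ) := by exact_mod_cast hp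
  have he : ∀ C : Matrix n n ℝ, exp ((((2 ^ k : ℕ) : ℝ))⁻¹ • C) ^ 2 ^ k = exp C := fun C => by
    rw [← Matrix.exp_nsmul, ← Nat.cast_smul_eq_nsmul ℝ, smul_smul, mul_inv_cancel₀, one_smul]
    positivity
  have := trace_mul_pow_two_pow_le_of k (fun i _ => abs_trace_pow_two_pow_le i) _ _
    (IsSymm.exp (hA.smul (((2 ^ k : ℕ) : ℝ))⁻¹)) (IsSymm.exp (hB.smul (((2 ^ k : ℕ) : ℝ))⁻¹))
  rw [he, he] at this
  simp only [Function.comp_apply, id, hp, hc]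
  exact this

theorem exists_orthogonal_diagonalization {n : Type*} [Fintype n] [DecidableEq n]
    {A : Matrix n n ℝ} (hA : A.IsSymm) :
    ∃ (U : Matrix n n ℝ) (d : n → ℝ), U * Uᵀ = 1 ∧ Uᵀ * U = 1 ∧ A = U * diagonal d * Uᵀ := by
  have hA' : A.IsHermitian := by simpa [IsHermitian] using hA.eq
  refine ⟨hA'.eigenvectorUnitary, hA'.eigenvalues, ?_, ?_, ?_⟩
  · simpa [star_eq_conjTranspose] using Unitary.coe_mul_star_self hA'.eigenvectorUnitary
  · simpa [star_eq_conjTranspose] using Unitary.coe_star_mul_self hA'.eigenvectorUnitary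
  · have := hA'.spectral_theorem
    rw [Unitary.conjStarAlgAut_apply] at this
    simpa [star_eq_conjTranspose, Function.comp_def] using this

theorem exp_mul_diagonal_mul_transpose {n : Type*} [Fintype n] [DecidableEq n]
    {U : Matrix n n ℝ} (d : n → ℝ) (h1 : U * Uᵀ = 1) :
    exp (U * diagonal d * Uᵀ) = U * diagonal (fun i => Real.exp (d i)) * Uᵀ := by
  have hinv : U⁻¹ = Uᵀ := inv_eq_right_inv h1
  have hU : IsUnit U := by
    rw [isUnit_iff_isUnit_det]
    exact isUnit_det_of_right_inverse h1
  rw [← hinv, exp_conj _ _ hU, exp_diagonal]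
  congr 3
  ext i
  rw [Real.exp_eq_exp_ℝ, Pi.coe_exp]

theorem posSemidef_one_add_add_sq_sub_exp {n : Type*} [Fintype n] [DecidableEq n]
    {A : Matrix n n ℝ} (hA : A.IsSymm) (hl : (1 - A).PosSemidef) (hu : (1 + A).PosSemidef) :
    (1 + A + A * A - exp A).PosSemidef := by
  obtain ⟨U, d, h1, h2, rfl⟩ := exists_orthogonal_diagonalization hA
  have hl' := hl.conjTranspose_mul_mul_same U
  have hu' := hu.conjTranspose_mul_mul_same U
  have e : Uᵀ * (U * diagonal d * Uᵀ) * U = diagonal d := by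
    calc _ = (Uᵀ * U) * diagonal d * (Uᵀ * U) := by simp only [mul_assoc]
      _ = _ := by rw [h2, one_mul, mul_one]
  rw [conjTranspose_eq_transpose_of_trivial, mul_sub, sub_mul, mul_one, h2, e,
    ← diagonal_one, diagonal_sub, posSemidef_diagonal_iff] at hl'
  rw [conjTranspose_eq_transpose_of_trivial, mul_add, add_mul, mul_one, h2, e,
    ← diagonal_one, diagonal_add, posSemidef_diagonal_iff] at hu'
  have e2 : U * diagonal d * Uᵀ * (U * diagonal d * Uᵀ)
      = U * diagonal (fun i => d i * d i) * Uᵀ := by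
    calc _ = U * diagonal d * (Uᵀ * U) * diagonal d * Uᵀ := by simp only [mul_assoc]
      _ = _ := by rw [h2, mul_one, mul_assoc U, diagonal_mul_diagonal]
  have e3 : 1 + U * diagonal d * Uᵀ + U * diagonal d * Uᵀ * (U * diagonal d * Uᵀ)
      - exp (U * diagonal d * Uᵀ)
      = U * diagonal (fun i => 1 + d i + d i * d i - Real.exp (d i)) * Uᴴ := by
    rw [exp_mul_diagonal_mul_transpose d h1, e2, conjTranspose_eq_transpose_of_trivial]
    simp only [← diagonal_sub, ← diagonal_add, mul_sub, mul_add, sub_mul, add_mul]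
    rw [diagonal_one, mul_one, h1]
  rw [e3]
  refine (PosSemidef.diagonal fun i => ?_).mul_mul_conjTranspose_same U
  have := (abs_le.1 (Real.abs_exp_sub_one_sub_id_le (x := d i)
    (abs_le.2 ⟨by linarith [hu' i], by linarith [hl' i]⟩))).2
  simp only [Pi.zero_apply]
  nlinarith

theorem exp_le_trace_exp {n : Type*} [Fintype n] [DecidableEq n] {A : Matrix n n ℝ}
    (hA : A.IsSymm) {s : ℝ} {v : n → ℝ} (hv : s * (v ⬝ᵥ v) < v ⬝ᵥ A *ᵥ v) :
    Real.exp s ≤ trace (exp A) := by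
  obtain ⟨U, d, h1, h2, rfl⟩ := exists_orthogonal_diagonalization hA
  rw [exp_mul_diagonal_mul_transpose d h1, trace_mul_comm, ← mul_assoc, h2, one_mul, trace_diagonal]
  by_contra! hlt
  have hd : ∀ i, d i ≤ s := fun i => Real.exp_le_exp.1
    ((Finset.single_le_sum (fun j _ => (Real.exp_pos (d j)).le) (Finset.mem_univ i)).trans hlt.le)
  have hpsd : (s • (1 : Matrix n n ℝ) - U * diagonal d * Uᵀ).PosSemidef := by
    have e : s • (1 : Matrix n n ℝ) - U * diagonal d * Uᵀ
        = U * diagonal (fun i => s - d i) * Uᴴ := by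
      rw [conjTranspose_eq_transpose_of_trivial, ← diagonal_sub, mul_sub, sub_mul,
        ← smul_one_eq_diagonal]
      simp [h1]
    rw [e]
    exact (PosSemidef.diagonal fun i => sub_nonneg.2 (hd i)).mul_mul_conjTranspose_same U
  have := hpsd.dotProduct_mulVec_nonneg v
  simp only [star_trivial, sub_mulVec, smul_mulVec, one_mulVec, dotProduct_sub,
    dotProduct_smul, smul_eq_mul] at this
  linarith

theorem trace_exp_mul_nonneg {n : Type*} [Fintype n] [DecidableEq n] {H B : Matrix n n ℝ}
    (hH : H.IsSymm) (hB : B.PosSemidef) : 0 ≤ trace (exp H * B) := by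
  have hs : (exp ((2 : ℝ)⁻¹ • H))ᵀ = exp ((2 : ℝ)⁻¹ • H) := (IsSymm.exp (hH.smul _)).eq
  have e : exp H = exp ((2 : ℝ)⁻¹ • H) * exp ((2 : ℝ)⁻¹ • H) := by
    rw [← Matrix.exp_add_of_commute _ _ (Commute.refl _), ← add_smul]
    norm_num
  rw [e, mul_assoc, trace_mul_comm]
  have := (hB.mul_mul_conjTranspose_same (exp ((2 : ℝ)⁻¹ • H))).trace_nonneg
  rwa [conjTranspose_eq_transpose_of_trivial, hs] at this

theorem trace_exp_nonneg {n : Type*} [Fintype n] [DecidableEq n] {H : Matrix n n ℝ}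
    (hH : H.IsSymm) : 0 ≤ trace (exp H) := by
  simpa using trace_exp_mul_nonneg hH PosSemidef.one

theorem measurable_ofReal_trace_exp {Ω n : Type*} [MeasurableSpace Ω] [Fintype n] [DecidableEq n]
    {F : Ω → Matrix n n ℝ} (hF : ∀ i j, Measurable fun w => F w i j) :
    Measurable fun w => ENNReal.ofReal (trace (exp (F w))) := by
  let _ : NormedRing (Matrix n n ℝ) := Matrix.linftyOpNormedRing
  let _ : NormedAlgebra ℝ (Matrix n n ℝ) := Matrix.linftyOpNormedAlgebra
  let _ : NormedAlgebra ℚ (Matrix n n ℝ) := NormedAlgebra.restrictScalars ℚ ℝ _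
  have hc : Continuous fun M : n → n → ℝ => trace (exp (Matrix.of M)) :=
    (continuous_id.matrix_trace (n := n) (R := ℝ)).comp
      ((NormedSpace.exp_continuous (𝔸 := Matrix n n ℝ)).comp continuous_id)
  have hm : Measurable fun w => (fun i j => F w i j : n → n → ℝ) :=
    measurable_pi_lambda _ fun i => measurable_pi_lambda _ fun j => hF i j
  exact ENNReal.measurable_ofReal.comp (hc.measurable.comp hm)

theorem integrable_trace_mul {Ω n : Type*} [MeasurableSpace Ω] [Fintype n] {μ : Measure Ω}
    (C : Matrix n n ℝ) {F : Ω → Matrix n n ℝ} (hF : ∀ i j, Integrable (fun w => F w i j) μ) :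
    Integrable (fun w => trace (C * F w)) μ := by
  simp only [trace, diag, mul_apply]
  exact integrable_finsetSum _ fun i _ => integrable_finsetSum _ fun j _ =>
    (hF j i).const_mul _

theorem integral_trace_mul {Ω n : Type*} [MeasurableSpace Ω] [Fintype n] {μ : Measure Ω}
    (C : Matrix n n ℝ) {F : Ω → Matrix n n ℝ} (hF : ∀ i j, Integrable (fun w => F w i j) μ) :
    ∫ w, trace (C * F w) ∂μ = trace (C * Matrix.of fun i j => ∫ w, F w i j ∂μ) := by
  simp only [trace, diag, mul_apply, of_apply]
  have h : ∀ i j, Integrable (fun w => C i j * F w j i) μ := fun i j => (hF j i).const_mul _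
  rw [integral_finsetSum _ fun i _ => integrable_finsetSum _ fun j _ => h i j]
  refine Finset.sum_congr rfl fun i _ => ?_
  rw [integral_finsetSum _ fun j _ => h i j]
  exact Finset.sum_congr rfl fun j _ => integral_const_mul _ _

theorem lintegral_trace_exp_add_le {Ω n : Type*} [MeasurableSpace Ω] [Fintype n] [DecidableEq n]
    {μ : Measure Ω} [IsProbabilityMeasure μ] {Z : Ω → Matrix n n ℝ} {v : ℝ}
    (hsymm : ∀ w, (Z w).IsSymm) (hl : ∀ w, (1 - Z w).PosSemidef) (hu : ∀ w, (1 + Z w).PosSemidef)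
    (hi : ∀ i j, Integrable (fun w => Z w i j) μ) (h0 : ∀ i j, ∫ w, Z w i j ∂μ = 0)
    (hi2 : ∀ i j, Integrable (fun w => (Z w * Z w) i j) μ)
    (hv : (v • (1 : Matrix n n ℝ) - Matrix.of fun i j => ∫ w, (Z w * Z w) i j ∂μ).PosSemidef)
    {H : Matrix n n ℝ} (hH : H.IsSymm) :
    ∫⁻ w, ENNReal.ofReal (trace (exp (H + Z w))) ∂μ
      ≤ ENNReal.ofReal ((1 + v) * trace (exp H)) := by
  have hpt : ∀ w, trace (exp (H + Z w)) ≤ trace (exp H * (1 + Z w + Z w * Z w)) := fun w => by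
    have h := trace_exp_mul_nonneg hH
      (posSemidef_one_add_add_sq_sub_exp (hsymm w) (hl w) (hu w))
    rw [mul_sub, trace_sub] at h
    linarith [trace_exp_add_le hH (hsymm w)]
  have hint : ∀ i j, Integrable (fun w => (1 + Z w + Z w * Z w) i j) μ := fun i j =>
    ((integrable_const _).add (hi i j)).add (hi2 i j)
  have hmean : (Matrix.of fun i j => ∫ w, (1 + Z w + Z w * Z w) i j ∂μ)
      = 1 + Matrix.of fun i j => ∫ w, (Z w * Z w) i j ∂μ := by
    ext i j
    simp only [of_apply, Matrix.add_apply]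
    have h1 : Integrable (fun w => (1 : Matrix n n ℝ) i j + Z w i j) μ :=
      (integrable_const _).add (hi i j)
    rw [integral_add h1 (hi2 i j), integral_add (integrable_const _) (hi i j), h0]
    simp
  calc ∫⁻ w, ENNReal.ofReal (trace (exp (H + Z w))) ∂μ
      ≤ ∫⁻ w, ENNReal.ofReal (trace (exp H * (1 + Z w + Z w * Z w))) ∂μ :=
        lintegral_mono fun w => ENNReal.ofReal_le_ofReal (hpt w)
    _ = ENNReal.ofReal (∫ w, trace (exp H * (1 + Z w + Z w * Z w)) ∂μ) :=
        (ofReal_integral_eq_lintegral_ofReal (integrable_trace_mul _ hint)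
          (ae_of_all _ fun w => (trace_exp_nonneg (hH.add (hsymm w))).trans (hpt w))).symm
    _ ≤ _ := by
        refine ENNReal.ofReal_le_ofReal ?_
        have h := trace_exp_mul_nonneg hH hv
        rw [mul_sub, trace_sub, Matrix.mul_smul, mul_one, trace_smul, smul_eq_mul] at h
        rw [integral_trace_mul _ hint, hmean, mul_add, trace_add, mul_one]
        linarith

theorem lintegral_pi_trace_exp_sum_le {Ω n : Type*} [MeasurableSpace Ω] [Fintype n]
    [DecidableEq n] {μ : Measure Ω} [IsProbabilityMeasure μ] {Z : Ω → Matrix n n ℝ} {C : ℝ}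
    (hC : 0 ≤ C) (hmeas : ∀ i j, Measurable fun w => Z w i j) (hsymm : ∀ w, (Z w).IsSymm)
    (hstep : ∀ H : Matrix n n ℝ, H.IsSymm →
      ∫⁻ w, ENNReal.ofReal (trace (exp (H + Z w))) ∂μ ≤ ENNReal.ofReal (C * trace (exp H)))
    (m : ℕ) : ∀ H : Matrix n n ℝ, H.IsSymm →
      ∫⁻ ws : Fin m → Ω, ENNReal.ofReal (trace (exp (H + ∑ r, Z (ws r))))
          ∂(Measure.pi fun _ => μ)
        ≤ ENNReal.ofReal (C ^ m * trace (exp H)) := by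
  induction m with
  | zero => intro H _; simp
  | succ m ih =>
    intro H hH
    have hF : Measurable fun p : Ω × (Fin m → Ω) =>
        ENNReal.ofReal (trace (exp (H + Z p.1 + ∑ r, Z (p.2 r)))) := by
      refine measurable_ofReal_trace_exp fun i j => ?_
      simp only [Matrix.add_apply, Matrix.sum_apply]
      exact ((measurable_const.add ((hmeas i j).comp measurable_fst))).add
        (Finset.measurable_sum _ fun r _ =>
          (hmeas i j).comp ((measurable_pi_apply r).comp measurable_snd))
    rw [← (measurePreserving_piFinSuccAbove (fun _ : Fin (m + 1) => μ) 0).symm.lintegral_comp_emb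
      (MeasurableEquiv.measurableEmbedding _)]
    have he : ∀ p : Ω × (Fin m → Ω), H + ∑ r, Z
        ((MeasurableEquiv.piFinSuccAbove (fun _ : Fin (m + 1) => Ω) 0).symm p r)
        = H + Z p.1 + ∑ r, Z (p.2 r) := fun p => by
      rw [Fin.sum_univ_succ, add_assoc]
      rfl
    simp only [he]
    rw [lintegral_prod _ hF.aemeasurable]
    calc _ ≤ ∫⁻ w, ENNReal.ofReal (C ^ m * trace (exp (H + Z w))) ∂μ :=
          lintegral_mono fun w => ih _ (hH.add (hsymm w))
      _ = ENNReal.ofReal (C ^ m) * ∫⁻ w, ENNReal.ofReal (trace (exp (H + Z w))) ∂μ := by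
          simp only [ENNReal.ofReal_mul (pow_nonneg hC m)]
          rw [lintegral_const_mul' _ _ ENNReal.ofReal_ne_top]
      _ ≤ ENNReal.ofReal (C ^ m) * ENNReal.ofReal (C * trace (exp H)) := by
          gcongr; exact hstep H hH
      _ = _ := by rw [← ENNReal.ofReal_mul (pow_nonneg hC m), ← mul_assoc, pow_succ]

/-- A matrix Bernstein inequality for sums of i.i.d. centred symmetric matrices `Z` with
`-1 ≼ Z ≼ 1` and `E[Z²] ≼ v`. -/
theorem measure_pi_quadraticForm_sum_le {Ω n : Type*} [MeasurableSpace Ω] [Fintype n]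
    [DecidableEq n] {μ : Measure Ω} [IsProbabilityMeasure μ] {Z : Ω → Matrix n n ℝ} {v : ℝ}
    (hv0 : 0 ≤ v) (hmeas : ∀ i j, Measurable fun w => Z w i j)
    (hsymm : ∀ w, (Z w).IsSymm) (hl : ∀ w, (1 - Z w).PosSemidef) (hu : ∀ w, (1 + Z w).PosSemidef)
    (hi : ∀ i j, Integrable (fun w => Z w i j) μ) (h0 : ∀ i j, ∫ w, Z w i j ∂μ = 0)
    (hi2 : ∀ i j, Integrable (fun w => (Z w * Z w) i j) μ)
    (hv : (v • (1 : Matrix n n ℝ) - Matrix.of fun i j => ∫ w, (Z w * Z w) i j ∂μ).PosSemidef)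
    (m : ℕ) (s : ℝ) :
    (Measure.pi fun _ : Fin m => μ)
        {ws | ∃ x : n → ℝ, s * (x ⬝ᵥ x) < x ⬝ᵥ (∑ r, Z (ws r)) *ᵥ x}
      ≤ ENNReal.ofReal (Fintype.card n * Real.exp (m * v - s)) := by
  have hsum : ∀ ws : Fin m → Ω, (∑ r, Z (ws r)).IsSymm := fun ws => by
    rw [IsSymm, transpose_sum]
    exact Finset.sum_congr rfl fun r _ => (hsymm _).eq
  have hE := lintegral_pi_trace_exp_sum_le (add_nonneg zero_le_one hv0) hmeas hsymm
    (fun H hH => lintegral_trace_exp_add_le hsymm hl hu hi h0 hi2 hv hH) m 0 isSymm_zero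
  simp only [zero_add, exp_zero, trace_one] at hE
  have hM : Measurable fun ws : Fin m → Ω => ENNReal.ofReal (trace (exp (∑ r, Z (ws r)))) := by
    refine measurable_ofReal_trace_exp fun i j => ?_
    simp only [Matrix.sum_apply]
    exact Finset.measurable_sum _ fun r _ => (hmeas i j).comp (measurable_pi_apply r)
  have hsub : {ws : Fin m → Ω | ∃ x : n → ℝ, s * (x ⬝ᵥ x) < x ⬝ᵥ (∑ r, Z (ws r)) *ᵥ x}
      ⊆ {ws | ENNReal.ofReal (Real.exp s) ≤ ENNReal.ofReal (trace (exp (∑ r, Z (ws r))))} :=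
    fun ws ⟨x, hx⟩ => ENNReal.ofReal_le_ofReal (exp_le_trace_exp (hsum ws) hx)
  refine (measure_mono hsub).trans ?_
  have hmk := (mul_meas_ge_le_lintegral hM (ENNReal.ofReal (Real.exp s))).trans hE
  have hpos : ENNReal.ofReal (Real.exp s) ≠ 0 := by simp [Real.exp_pos]
  rw [mul_comm] at hmk
  refine ((ENNReal.le_div_iff_mul_le (Or.inl hpos) (Or.inl ENNReal.ofReal_ne_top)).2 hmk).trans ?_
  rw [← ENNReal.ofReal_div_of_pos (Real.exp_pos s)]
  refine ENNReal.ofReal_le_ofReal ?_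
  rw [Real.exp_sub, Real.exp_nat_mul, mul_div_assoc', mul_comm]
  gcongr
  linarith [Real.add_one_le_exp v]

/-- The Hermitian dilation of a real rectangular matrix. -/
def hermitianDilation {α β : Type*} (S : Matrix α β ℝ) : Matrix (α ⊕ β) (α ⊕ β) ℝ :=
  fromBlocks 0 S Sᵀ 0

theorem hermitianDilation_isSymm {α β : Type*} (S : Matrix α β ℝ) :
    (hermitianDilation S).IsSymm := by
  simp [hermitianDilation, IsSymm, fromBlocks_transpose]

theorem hermitianDilation_sub {α β : Type*} (S T : Matrix α β ℝ) :
    hermitianDilation (S - T) = hermitianDilation S - hermitianDilation T := by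
  ext (i | i) (j | j) <;> simp [hermitianDilation]

theorem hermitianDilation_smul {α β : Type*} (c : ℝ) (S : Matrix α β ℝ) :
    hermitianDilation (c • S) = c • hermitianDilation S := by
  ext (i | i) (j | j) <;> simp [hermitianDilation]

theorem hermitianDilation_sum {α β ι : Type*} [Fintype ι] (S : ι → Matrix α β ℝ) :
    hermitianDilation (∑ r, S r) = ∑ r, hermitianDilation (S r) := by
  ext (i | i) (j | j) <;> simp [hermitianDilation, Matrix.sum_apply]

theorem dotProduct_hermitianDilation_mulVec {α β : Type*} [Fintype α] [Fintype β]
    (S : Matrix α β ℝ) (y : α → ℝ) (z : β → ℝ) :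
    Sum.elim y z ⬝ᵥ hermitianDilation S *ᵥ Sum.elim y z = 2 * (y ⬝ᵥ S *ᵥ z) := by
  have : z ⬝ᵥ Sᵀ *ᵥ y = y ⬝ᵥ S *ᵥ z := by
    rw [mulVec_transpose, dotProduct_comm, ← dotProduct_mulVec]
  rw [hermitianDilation, fromBlocks_mulVec, sumElim_dotProduct_sumElim]
  simp only [Sum.elim_comp_inl, Sum.elim_comp_inr, zero_mulVec, zero_add, add_zero, this]
  ring

theorem exists_lt_dotProduct_of_lt_specNorm {α β : Type*} [Fintype α] [Fintype β] [DecidableEq β]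
    {S : Matrix α β ℝ} {t : ℝ} (ht : 0 ≤ t) (h : t < specNorm S) :
    ∃ x : α ⊕ β → ℝ, t * (x ⬝ᵥ x) < x ⬝ᵥ hermitianDilation S *ᵥ x := by
  by_contra! hx
  refine h.not_ge (ContinuousLinearMap.opNorm_le_bound _ ht fun z => ?_)
  set u : EuclideanSpace ℝ α := Matrix.toEuclideanLin S z with hu
  change ‖u‖ ≤ t * ‖z‖
  have hz2 : z.ofLp ⬝ᵥ z.ofLp = ‖z‖ ^ 2 := by
    rw [EuclideanSpace.real_norm_sq_eq]; simp [dotProduct, sq]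
  have hu2 : u.ofLp ⬝ᵥ u.ofLp = ‖u‖ ^ 2 := by
    rw [EuclideanSpace.real_norm_sq_eq]; simp [dotProduct, sq]
  have hSz : S *ᵥ z.ofLp = u.ofLp := rfl
  have key := hx (Sum.elim (‖z‖ • u.ofLp) (‖u‖ • z.ofLp))
  rw [dotProduct_hermitianDilation_mulVec, sumElim_dotProduct_sumElim] at key
  simp only [mulVec_smul, hSz, smul_dotProduct, dotProduct_smul, smul_eq_mul, hz2, hu2] at key
  rcases (norm_nonneg z).eq_or_lt with h0 | hzpos
  · have : z = 0 := norm_eq_zero.1 h0.symm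
    simp [hu, this]
  rcases (norm_nonneg u).eq_or_lt with h0 | hupos
  · rw [← h0]; positivity
  have hp : 0 < 2 * (‖z‖ * ‖u‖ ^ 2) := by positivity
  refine le_of_mul_le_mul_left ?_ hp
  linarith

theorem dotProduct_sq_le {n : Type*} [Fintype n] (p q : n → ℝ) :
    (p ⬝ᵥ q) ^ 2 ≤ (p ⬝ᵥ p) * (q ⬝ᵥ q) := by
  simpa [dotProduct, sq] using Finset.sum_mul_sq_le_sq_mul_sq Finset.univ p q

theorem abs_two_mul_dotProduct_vecMulVec_le {α β : Type*} [Fintype α] [Fintype β]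
    {a : α → ℝ} {b : β → ℝ} {K : ℝ} (ha : a ⬝ᵥ a ≤ K) (hb : b ⬝ᵥ b ≤ K)
    (y : α → ℝ) (z : β → ℝ) :
    |2 * (y ⬝ᵥ vecMulVec a b *ᵥ z)| ≤ K * (y ⬝ᵥ y + z ⬝ᵥ z) := by
  have hy0 : 0 ≤ y ⬝ᵥ y := Finset.sum_nonneg fun i _ => mul_self_nonneg _
  have hz0 : 0 ≤ z ⬝ᵥ z := Finset.sum_nonneg fun i _ => mul_self_nonneg _
  have h1 : (y ⬝ᵥ a) ^ 2 ≤ K * (y ⬝ᵥ y) := (dotProduct_sq_le y a).trans (by nlinarith)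
  have h2 : (b ⬝ᵥ z) ^ 2 ≤ K * (z ⬝ᵥ z) := (dotProduct_sq_le b z).trans (by nlinarith)
  have e : y ⬝ᵥ vecMulVec a b *ᵥ z = (y ⬝ᵥ a) * (b ⬝ᵥ z) := by
    rw [vecMulVec_mulVec]; simp [dotProduct_smul, mul_comm]
  rw [e, abs_le]
  constructor <;> nlinarith [sq_nonneg (y ⬝ᵥ a + b ⬝ᵥ z), sq_nonneg (y ⬝ᵥ a - b ⬝ᵥ z)]

theorem abs_two_mul_dotProduct_indicator_le {ι : Type*} [DecidableEq ι] (A B : Finset ι)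
    (y : A → ℝ) (z : B → ℝ) :
    |2 * (y ⬝ᵥ (Matrix.of fun (s : A) (t : B) => if (s : ι) = t then (1 : ℝ) else 0) *ᵥ z)|
      ≤ y ⬝ᵥ y + z ⬝ᵥ z := by
  have hrow : ∀ s : A, ∑ t : B, (if (s : ι) = t then (1 : ℝ) else 0) ≤ 1 := fun s => by
    have hc : (Finset.univ.filter fun t : B => (s : ι) = t).card ≤ 1 :=
      Finset.card_le_one.2 fun t ht t' ht' => by
        simp only [Finset.mem_filter, Finset.mem_univ, true_and] at ht ht'
        exact Subtype.ext (ht.symm.trans ht')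
    rw [Finset.sum_boole]
    exact_mod_cast hc
  have hcol : ∀ t : B, ∑ s : A, (if (s : ι) = t then (1 : ℝ) else 0) ≤ 1 := fun t => by
    have hc : (Finset.univ.filter fun s : A => (s : ι) = t).card ≤ 1 :=
      Finset.card_le_one.2 fun s hs s' hs' => by
        simp only [Finset.mem_filter, Finset.mem_univ, true_and] at hs hs'
        exact Subtype.ext (hs.trans hs'.symm)
    rw [Finset.sum_boole]
    exact_mod_cast hc
  have e : 2 * (y ⬝ᵥ (Matrix.of fun (s : A) (t : B) => if (s : ι) = t then (1 : ℝ) else 0) *ᵥ z)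
      = ∑ s : A, ∑ t : B, 2 * (y s * ((if (s : ι) = t then (1 : ℝ) else 0) * z t)) := by
    simp only [dotProduct, mulVec, of_apply, Finset.mul_sum]
  rw [e]
  calc _ ≤ ∑ s : A, ∑ t : B, (if (s : ι) = t then (1 : ℝ) else 0) * (y s * y s + z t * z t) := by
        refine (Finset.abs_sum_le_sum_abs _ _).trans (Finset.sum_le_sum fun s _ => ?_)
        refine (Finset.abs_sum_le_sum_abs _ _).trans (Finset.sum_le_sum fun t _ => ?_)
        split_ifs
        · rw [abs_le]
          constructor <;> nlinarith [sq_nonneg (y s + z t), sq_nonneg (y s - z t)]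
        · simp
    _ = ∑ s : A, (∑ t : B, (if (s : ι) = t then (1 : ℝ) else 0)) * (y s * y s)
        + ∑ t : B, (∑ s : A, (if (s : ι) = t then (1 : ℝ) else 0)) * (z t * z t) := by
        simp only [mul_add, Finset.sum_add_distrib, Finset.sum_mul]
        congr 1
        exact Finset.sum_comm
    _ ≤ _ := by
        refine add_le_add (Finset.sum_le_sum fun s _ => ?_) (Finset.sum_le_sum fun t _ => ?_)
        · exact mul_le_of_le_one_left (mul_self_nonneg _) (hrow s)
        · exact mul_le_of_le_one_left (mul_self_nonneg _) (hcol t)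

theorem posSemidef_one_sub_and_one_add {n : Type*} [Fintype n] [DecidableEq n]
    {A : Matrix n n ℝ} (hA : A.IsSymm) (h : ∀ x, |x ⬝ᵥ A *ᵥ x| ≤ x ⬝ᵥ x) :
    (1 - A).PosSemidef ∧ (1 + A).PosSemidef := by
  have hA' : A.IsHermitian := by simpa [IsHermitian] using hA.eq
  refine ⟨.of_dotProduct_mulVec_nonneg (isHermitian_one.sub hA') fun x => ?_,
    .of_dotProduct_mulVec_nonneg (isHermitian_one.add hA') fun x => ?_⟩
  · rw [star_trivial, sub_mulVec, one_mulVec, dotProduct_sub]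
    linarith [(abs_le.1 (h x)).2]
  · rw [star_trivial, add_mulVec, one_mulVec, dotProduct_add]
    linarith [(abs_le.1 (h x)).1]

theorem hermitianDilation_vecMulVec_mul_self {α β : Type*} [Fintype α] [Fintype β]
    (a : α → ℝ) (b : β → ℝ) :
    hermitianDilation (vecMulVec a b) * hermitianDilation (vecMulVec a b)
      = fromBlocks ((b ⬝ᵥ b) • vecMulVec a a) 0 0 ((a ⬝ᵥ a) • vecMulVec b b) := by
  simp [hermitianDilation, fromBlocks_multiply, transpose_vecMulVec, vecMulVec_mul_vecMulVec,
    vecMulVec_smul]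

theorem integral_sub_mul_sub {Ω n : Type*} [MeasurableSpace Ω] [Fintype n] {μ : Measure Ω}
    [IsProbabilityMeasure μ] {D : Ω → Matrix n n ℝ} {E : Matrix n n ℝ}
    (hD : ∀ i j, Integrable (fun w => D w i j) μ) (hE : ∀ i j, ∫ w, D w i j ∂μ = E i j)
    (hDD : ∀ i j, Integrable (fun w => (D w * D w) i j) μ) (i j : n) :
    Integrable (fun w => ((D w - E) * (D w - E)) i j) μ ∧
    ∫ w, ((D w - E) * (D w - E)) i j ∂μ = ∫ w, (D w * D w) i j ∂μ - (E * E) i j := by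
  have e : ∀ w, ((D w - E) * (D w - E)) i j = (D w * D w) i j
      - (∑ k, (D w i k * E k j + E i k * D w k j)) + (E * E) i j := fun w => by
    rw [sub_mul, mul_sub, mul_sub]
    simp only [Matrix.sub_apply, mul_apply, Finset.sum_add_distrib]
    ring
  have h1 : ∀ k, Integrable (fun w => D w i k * E k j) μ := fun k => (hD i k).mul_const _
  have h2 : ∀ k, Integrable (fun w => E i k * D w k j) μ := fun k => (hD k j).const_mul _
  have h3 : ∀ k, Integrable (fun w => D w i k * E k j + E i k * D w k j) μ :=
    fun k => (h1 k).add (h2 k)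
  have h4 : Integrable (fun w => ∑ k, (D w i k * E k j + E i k * D w k j)) μ :=
    integrable_finsetSum _ fun k _ => h3 k
  have h5 : Integrable (fun w => (D w * D w) i j
      - (∑ k, (D w i k * E k j + E i k * D w k j))) μ := (hDD i j).sub h4
  simp only [e]
  refine ⟨h5.add (integrable_const _), ?_⟩
  rw [integral_add h5 (integrable_const _), integral_sub (hDD i j) h4,
    integral_finsetSum _ fun k _ => h3 k]
  have e2 : ∀ k, ∫ w, (D w i k * E k j + E i k * D w k j) ∂μ = 2 * (E i k * E k j) := fun k => by
    rw [integral_add (h1 k) (h2 k), integral_mul_const, integral_const_mul, hE, hE]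
    ring
  simp only [e2, ← Finset.mul_sum, ← mul_apply]
  simp
  ring

theorem integrable_mul_of_orthonormal {Ω ι : Type*} [MeasurableSpace Ω] [DecidableEq ι]
    {μ : Measure Ω} {Y : ι → Ω → ℝ} (hmeas : ∀ i, Measurable (Y i))
    (horth : ∀ i j, ∫ x, Y i x * Y j x ∂μ = if i = j then 1 else 0) (i j : ι) :
    Integrable (fun x => Y i x * Y j x) μ := by
  have h2 : ∀ k, MemLp (Y k) 2 μ := fun k => by
    rw [memLp_two_iff_integrable_sq (hmeas k).aestronglyMeasurable]
    by_contra hk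
    have h := horth k k
    simp only [← sq, if_true] at h
    rw [integral_undef hk] at h
    exact zero_ne_one h
  exact (h2 i).integrable_mul (h2 j)

/-- Tail bound for the deviation of the empirical cross Gram matrix of two families of functions
that are orthonormal and have constant sum of squares. -/
theorem measure_pi_lt_specNorm_sum_sub_le {Ω ι : Type*} [MeasurableSpace Ω] [DecidableEq ι]
    {μ : Measure Ω} [IsProbabilityMeasure μ] {Y : ι → Ω → ℝ} (hmeas : ∀ i, Measurable (Y i))
    (horth : ∀ i j, ∫ x, Y i x * Y j x ∂μ = if i = j then 1 else 0) {A B : Finset ι}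
    {cA cB K : ℝ} (hK : 1 ≤ K) (hcA : cA ≤ K) (hcB : cB ≤ K)
    (hA : ∀ w, ∑ j ∈ A, Y j w ^ 2 = cA) (hB : ∀ w, ∑ j ∈ B, Y j w ^ 2 = cB)
    {m : ℕ} (hm : 0 < m) {t : ℝ} (ht0 : 0 < t) (ht1 : t ≤ 1) :
    (Measure.pi fun _ : Fin m => μ)
        {ws | t < specNorm ((m : ℝ)⁻¹ • ∑ r, vecMulVec (fun s : A => Y s (ws r))
            (fun s : B => Y s (ws r)) - Matrix.of fun (s : A) (t : B) =>
              if (s : ι) = t then (1 : ℝ) else 0)}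
      ≤ ENNReal.ofReal ((A.card + B.card : ℕ) * Real.exp (-(m * t ^ 2 / (4 * K)))) := by
  have hK0 : 0 < K := zero_lt_one.trans_le hK
  have hm0 : (0 : ℝ) < m := by exact_mod_cast hm
  set P : Ω → Matrix A B ℝ := fun w => vecMulVec (fun s : A => Y s w) (fun s : B => Y s w) with hP
  set E : Matrix A B ℝ := Matrix.of fun (s : A) (t : B) => if (s : ι) = t then (1 : ℝ) else 0
    with hE
  set θ : ℝ := t / (2 * K) with hθ
  have hθ0 : 0 < θ := by positivity
  have haa : ∀ w, (fun s : A => Y s w) ⬝ᵥ (fun s : A => Y s w) = cA := fun w => by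
    rw [← hA w, ← Finset.sum_coe_sort]; simp [dotProduct, sq]
  have hbb : ∀ w, (fun s : B => Y s w) ⬝ᵥ (fun s : B => Y s w) = cB := fun w => by
    rw [← hB w, ← Finset.sum_coe_sort]; simp [dotProduct, sq]
  have hYY := integrable_mul_of_orthonormal hmeas horth
  set D : Ω → Matrix (A ⊕ B) (A ⊕ B) ℝ := fun w => hermitianDilation (P w) with hD
  have hDD : ∀ w, D w * D w = fromBlocks
      (cB • vecMulVec (fun s : A => Y s w) fun s : A => Y s w) 0 0
      (cA • vecMulVec (fun s : B => Y s w) fun s : B => Y s w) := fun w => by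
    rw [hD, hP, hermitianDilation_vecMulVec_mul_self, haa, hbb]
  have hDmeas : ∀ i j, Measurable fun w => D w i j := by
    rintro (i | i) (j | j) <;> simp only [hD, hP, hermitianDilation, fromBlocks_apply₁₁,
      fromBlocks_apply₁₂, fromBlocks_apply₂₁, fromBlocks_apply₂₂, transpose_apply, Matrix.zero_apply,
      vecMulVec_apply]
    · exact measurable_const
    · exact (hmeas _).mul (hmeas _)
    · exact (hmeas _).mul (hmeas _)
    · exact measurable_const
  have hDint : ∀ i j, Integrable (fun w => D w i j) μ := by
    rintro (i | i) (j | j) <;> simp only [hD, hP, hermitianDilation, fromBlocks_apply₁₁,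
      fromBlocks_apply₁₂, fromBlocks_apply₂₁, fromBlocks_apply₂₂, transpose_apply, Matrix.zero_apply,
      vecMulVec_apply]
    · exact integrable_const _
    · exact hYY _ _
    · exact hYY _ _
    · exact integrable_const _
  have hDE : ∀ i j, ∫ w, D w i j ∂μ = hermitianDilation E i j := by
    rintro (i | i) (j | j) <;> simp [hD, hP, hE, hermitianDilation, vecMulVec_apply, horth, eq_comm]
  have hDDint : ∀ i j, Integrable (fun w => (D w * D w) i j) μ := by
    simp only [hDD]
    rintro (i | i) (j | j) <;> simp only [fromBlocks_apply₁₁, fromBlocks_apply₁₂,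
      fromBlocks_apply₂₁, fromBlocks_apply₂₂, Matrix.zero_apply, Matrix.smul_apply, vecMulVec_apply,
      smul_eq_mul]
    · exact (hYY _ _).const_mul _
    · exact integrable_const _
    · exact integrable_const _
    · exact (hYY _ _).const_mul _
  have hDDE : ∀ i j, ∫ w, (D w * D w) i j ∂μ
      = diagonal (Sum.elim (fun _ : A => cB) fun _ : B => cA) i j := by
    simp only [hDD]
    rintro (i | i) (j | j) <;> simp [vecMulVec_apply, integral_const_mul, horth, diagonal_apply]
  set Z : Ω → Matrix (A ⊕ B) (A ⊕ B) ℝ := fun w => θ • (D w - hermitianDilation E) with hZ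
  have hZdil : ∀ w, Z w = hermitianDilation (θ • (P w - E)) := fun w => by
    rw [hermitianDilation_smul, hermitianDilation_sub]
  have hZsymm : ∀ w, (Z w).IsSymm := fun w => hZdil w ▸ hermitianDilation_isSymm _
  have hZZ : ∀ w i j, (Z w * Z w) i j
      = θ ^ 2 * ((D w - hermitianDilation E) * (D w - hermitianDilation E)) i j := fun w i j => by
    rw [hZ, smul_mul_smul_comm, Matrix.smul_apply, smul_eq_mul, sq]
  have hsq := integral_sub_mul_sub hDint hDE hDDint
  have hbd : ∀ w x, |x ⬝ᵥ Z w *ᵥ x| ≤ x ⬝ᵥ x := fun w x => by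
    obtain ⟨y, z, rfl⟩ : ∃ y z, x = Sum.elim y z := ⟨_, _, (Sum.elim_comp_inl_inr x).symm⟩
    have h1 := abs_two_mul_dotProduct_vecMulVec_le ((haa w).trans_le hcA) ((hbb w).trans_le hcB) y z
    have h2 := abs_two_mul_dotProduct_indicator_le A B y z
    have e : Sum.elim y z ⬝ᵥ Z w *ᵥ Sum.elim y z
        = θ * (2 * (y ⬝ᵥ P w *ᵥ z) - 2 * (y ⬝ᵥ E *ᵥ z)) := by
      rw [hZ, smul_mulVec, dotProduct_smul, sub_mulVec, dotProduct_sub, hD,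
        dotProduct_hermitianDilation_mulVec, dotProduct_hermitianDilation_mulVec, smul_eq_mul]
    have hn : 0 ≤ y ⬝ᵥ y + z ⬝ᵥ z := add_nonneg (Finset.sum_nonneg fun i _ => mul_self_nonneg _)
      (Finset.sum_nonneg fun i _ => mul_self_nonneg _)
    rw [e, abs_mul, abs_of_pos hθ0, sumElim_dotProduct_sumElim]
    have hθK : θ * (2 * K) = t := by rw [hθ]; field_simp
    calc θ * |2 * (y ⬝ᵥ P w *ᵥ z) - 2 * (y ⬝ᵥ E *ᵥ z)|
        ≤ θ * (K * (y ⬝ᵥ y + z ⬝ᵥ z) + (y ⬝ᵥ y + z ⬝ᵥ z)) := by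
          gcongr
          exact (abs_sub _ _).trans (add_le_add h1 h2)
      _ ≤ θ * (2 * K * (y ⬝ᵥ y + z ⬝ᵥ z)) := by
          gcongr
          nlinarith
      _ = t * (y ⬝ᵥ y + z ⬝ᵥ z) := by rw [← mul_assoc, hθK]
      _ ≤ _ := mul_le_of_le_one_left hn ht1
  have hps := fun w => posSemidef_one_sub_and_one_add (hZsymm w) (hbd w)
  have hv : (((t ^ 2 / (4 * K)) • (1 : Matrix (A ⊕ B) (A ⊕ B) ℝ)) -
      Matrix.of fun i j => ∫ w, (Z w * Z w) i j ∂μ).PosSemidef := by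
    have e : ((t ^ 2 / (4 * K)) • (1 : Matrix (A ⊕ B) (A ⊕ B) ℝ)) -
        Matrix.of (fun i j => ∫ w, (Z w * Z w) i j ∂μ)
        = θ ^ 2 • (diagonal (Sum.elim (fun _ : A => K - cB) fun _ : B => K - cA)
          + hermitianDilation E * (hermitianDilation E)ᴴ) := by
      have hE2 : (hermitianDilation E)ᴴ = hermitianDilation E := by
        rw [conjTranspose_eq_transpose_of_trivial, (hermitianDilation_isSymm E).eq]
      have hθv : t ^ 2 / (4 * K) = θ ^ 2 * K := by rw [hθ]; field_simp; norm_num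
      rw [hE2]
      ext i j
      simp only [Matrix.sub_apply, Matrix.smul_apply, Matrix.add_apply, of_apply, hZZ,
        integral_const_mul, (hsq _ _).2, hDDE, hθv, smul_eq_mul, diagonal_apply, one_apply]
      rcases i with i | i <;> rcases j with j | j <;> simp <;> split_ifs <;> ring
    rw [e]
    refine PosSemidef.smul (PosSemidef.add (PosSemidef.diagonal ?_)
      (posSemidef_self_mul_conjTranspose _)) (sq_nonneg θ)
    rintro (i | i) <;> simp [hcA, hcB]
  have key := measure_pi_quadraticForm_sum_le (μ := μ) (Z := Z) (v := t ^ 2 / (4 * K))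
    (by positivity)
    (fun i j => by
      simp only [hZ, Matrix.smul_apply, Matrix.sub_apply]
      exact ((hDmeas i j).sub_const _).const_smul θ)
    hZsymm (fun w => (hps w).1) (fun w => (hps w).2)
    (fun i j => by
      simp only [hZ, Matrix.smul_apply, Matrix.sub_apply]
      exact ((hDint i j).sub (integrable_const _)).smul θ)
    (fun i j => by
      simp only [hZ, Matrix.smul_apply, Matrix.sub_apply]
      rw [integral_smul, integral_sub (hDint i j) (integrable_const _), hDE]
      simp)
    (fun i j => by
      simp only [hZZ]
      exact (hsq i j).1.const_mul _)
    hv m (θ * m * t)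
  have hexp : m * (t ^ 2 / (4 * K)) - θ * m * t = -(m * t ^ 2 / (4 * K)) := by
    rw [hθ]; field_simp; ring
  rw [hexp, Fintype.card_sum, Fintype.card_coe, Fintype.card_coe] at key
  refine (measure_mono fun ws hws => ?_).trans key
  obtain ⟨x, hx⟩ := exists_lt_dotProduct_of_lt_specNorm ht0.le hws
  refine ⟨x, ?_⟩
  have e : ∑ r, Z (ws r) = (θ * m) • hermitianDilation ((m : ℝ)⁻¹ • ∑ r, P (ws r) - E) := by
    simp only [hZdil]
    rw [← hermitianDilation_sum, ← hermitianDilation_smul, ← Finset.smul_sum,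
      Finset.sum_sub_distrib, mul_smul, smul_sub (m : ℝ), smul_inv_smul₀ hm0.ne']
    simp [Nat.cast_smul_eq_nsmul]
  rw [e, smul_mulVec, dotProduct_smul, smul_eq_mul, mul_assoc (θ * m)]
  exact mul_lt_mul_of_pos_left hx (by positivity)

end

/-- Let `(X, μ)` be a probability space and `Y₀, …, Y_{M−1} : X → ℝ` measurable functions
orthonormal in `L²(μ)`.  Let `A`, `B` be nonempty subsets of `{0,…,M−1}` such that
`Σ_{j∈A} Y_j(w)² = c_A` and `Σ_{j∈B} Y_j(w)² = c_B` for every `w ∈ X`, with `c_A, c_B ∈ [1, M]`.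
Let `w₁, …, w_m` be i.i.d. samples from `μ` and form the matrices `𝐀 ∈ ℝ^{A×m}`,
`𝐁 ∈ ℝ^{B×m}` of sampled values, and let `Ē ∈ ℝ^{A×B}` have entries `1` exactly on matching
indices (so `Ē = E[(1/m)𝐀𝐁ᵀ]`).  Then for every `δ ∈ (0,1)`, if `m ≥ 4 M log(2M/δ)`, with
probability at least `1 − δ` : `‖(1/m)𝐀𝐁ᵀ − Ē‖₂ ≤ √(4 M log(2M/δ) / m)`. -/
theorem sampled_orthonormal_gram_concentration
    {X : Type*} [MeasurableSpace X] (μ : Measure X) [IsProbabilityMeasure μ]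
    (M : ℕ) (Y : Fin M → X → ℝ) (hmeas : ∀ i, Measurable (Y i))
    (horth : ∀ i j, ∫ x, Y i x * Y j x ∂μ = if i = j then 1 else 0)
    (A B : Finset (Fin M)) (hA : A.Nonempty) (hB : B.Nonempty)
    (cA cB : ℝ) (hcA1 : 1 ≤ cA) (hcAM : cA ≤ M) (hcB1 : 1 ≤ cB) (hcBM : cB ≤ M)
    (hAconst : ∀ w : X, ∑ j ∈ A, Y j w ^ 2 = cA)
    (hBconst : ∀ w : X, ∑ j ∈ B, Y j w ^ 2 = cB)
    (m : ℕ) (δ : ℝ) (hδ0 : 0 < δ) (hδ1 : δ < 1)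
    (hm : 4 * M * Real.log (2 * M / δ) ≤ (m : ℝ)) :
    (Measure.pi fun _ : Fin m => μ)
        {ws : Fin m → X |
          specNorm
              ((m : ℝ)⁻¹ •
                  ((Matrix.of fun (s : ↥A) (r : Fin m) => Y s.1 (ws r)) *
                    (Matrix.of fun (t : ↥B) (r : Fin m) => Y t.1 (ws r))ᵀ) -
                Matrix.of fun (s : ↥A) (t : ↥B) => if (s.1 : Fin M) = t.1 then 1 else 0) ≤
            Real.sqrt (4 * M * Real.log (2 * M / δ) / m)} ≥
      ENNReal.ofReal (1 - δ) := by
  have hM1 : (1 : ℝ) ≤ M := hcA1.trans hcAM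
  have hM0 : (0 : ℝ) < M := zero_lt_one.trans_le hM1
  set L : ℝ := Real.log (2 * M / δ) with hL
  have hL0 : 0 < L := Real.log_pos (by rw [lt_div_iff₀ hδ0]; linarith)
  have hm0 : (0 : ℝ) < m := lt_of_lt_of_le (by positivity) hm
  set t : ℝ := Real.sqrt (4 * M * L / m) with ht
  have ht0 : 0 < t := Real.sqrt_pos.2 (by positivity)
  have ht1 : t ≤ 1 := Real.sqrt_le_one.2 ((div_le_one hm0).2 hm)
  have ht2 : m * t ^ 2 / (4 * M) = L := by
    rw [ht, Real.sq_sqrt (by positivity)]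
    field_simp
  have key := measure_pi_lt_specNorm_sum_sub_le hmeas horth hM1 hcAM hcBM hAconst hBconst
    (Nat.cast_pos.1 hm0) ht0 ht1
  rw [ht2] at key
  have hcard : ((A.card + B.card : ℕ) : ℝ) ≤ 2 * M := by
    have h1 := card_finset_fin_le A
    have h2 := card_finset_fin_le B
    exact_mod_cast (by omega : A.card + B.card ≤ 2 * M)
  have hle : ((A.card + B.card : ℕ) : ℝ) * Real.exp (-L) ≤ δ := by
    refine (mul_le_mul_of_nonneg_right hcard (Real.exp_pos _).le).trans ?_
    rw [hL, Real.exp_neg, Real.exp_log (by positivity)]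
    field_simp
    exact le_rfl
  set S := {ws : Fin m → X |
          specNorm
              ((m : ℝ)⁻¹ •
                  ((Matrix.of fun (s : ↥A) (r : Fin m) => Y s.1 (ws r)) *
                    (Matrix.of fun (t : ↥B) (r : Fin m) => Y t.1 (ws r))ᵀ) -
                Matrix.of fun (s : ↥A) (t : ↥B) => if (s.1 : Fin M) = t.1 then 1 else 0) ≤ t}
    with hS
  have hSc : (Measure.pi fun _ : Fin m => μ) Sᶜ ≤ ENNReal.ofReal δ := by
    refine (measure_mono fun ws hws => ?_).trans (key.trans (ENNReal.ofReal_le_ofReal hle))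
    have e : (Matrix.of fun (s : ↥A) (r : Fin m) => Y s.1 (ws r)) *
        (Matrix.of fun (t : ↥B) (r : Fin m) => Y t.1 (ws r))ᵀ
        = ∑ r, vecMulVec (fun s : A => Y s (ws r)) (fun s : B => Y s (ws r)) := by
      ext i j
      simp [mul_apply, Matrix.sum_apply, vecMulVec_apply]
    rw [hS, Set.mem_compl_iff, Set.mem_ofPred_eq, not_le, e] at hws
    exact hws
  have h1 : 1 ≤ (Measure.pi fun _ : Fin m => μ) S + ENNReal.ofReal δ := by
    calc (1 : ENNReal) = (Measure.pi fun _ : Fin m => μ) Set.univ := measure_univ.symm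
      _ ≤ _ := by
        rw [← Set.union_compl_self S]
        exact (measure_union_le _ _).trans (by gcongr)
  rw [ge_iff_le, ENNReal.ofReal_sub _ hδ0.le, ENNReal.ofReal_one]
  exact tsub_le_iff_right.2 h1
end

section
/- Assume the orthonormal-family setup with groups ℓ = 0,…,ℓ̂, activation σ and kernel K. Let S := Σ_{ℓ=0}^{ℓ̂} √N_ℓ, let q₁, …, q_m be i.i.d. samples from μ, and define the empirical kernel K̂(x,x') := (1/m) Σ_{r=1}^m σ(x, q_r) σ(q_r, x'). Then there is an absolute constant C > 0 such that for every fixed x' ∈ X and every δ ∈ (0,1), with probability at least 1 − δ over q₁,…,q_m: sup_{x ∈ X} |K̂(x,x') − K(x,x')| ≤ C · S² · √( log(2/δ) / m ). -/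
open MeasureTheory

/-- The activation `σ(x,x') := Σ_{ℓ=0}^{ℓ̂} N_ℓ^{−1/2} Σ_{j=1}^{N_ℓ} Y_{ℓ,j}(x) Y_{ℓ,j}(x')`. -/
noncomputable def chanAct {X : Type*} {L : ℕ} {N : Fin (L + 1) → ℕ}
    (Y : ((ℓ : Fin (L + 1)) × Fin (N ℓ)) → X → ℝ) (x x' : X) : ℝ :=
  ∑ ℓ : Fin (L + 1), (Real.sqrt (N ℓ))⁻¹ * ∑ j : Fin (N ℓ), Y ⟨ℓ, j⟩ x * Y ⟨ℓ, j⟩ x'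

/-- The kernel `K(x,x') := Σ_{ℓ=0}^{ℓ̂} N_ℓ^{−1} Σ_{j=1}^{N_ℓ} Y_{ℓ,j}(x) Y_{ℓ,j}(x')`. -/
noncomputable def chanKer {X : Type*} {L : ℕ} {N : Fin (L + 1) → ℕ}
    (Y : ((ℓ : Fin (L + 1)) × Fin (N ℓ)) → X → ℝ) (x x' : X) : ℝ :=
  ∑ ℓ : Fin (L + 1), ((N ℓ : ℝ))⁻¹ * ∑ j : Fin (N ℓ), Y ⟨ℓ, j⟩ x * Y ⟨ℓ, j⟩ x'

section HilbertConcentration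

variable {X : Type*} [MeasurableSpace X] {μ : Measure X} [IsProbabilityMeasure μ]
  {E : Type*} [NormedAddCommGroup E] [InnerProductSpace ℝ E] [MeasurableSpace E] [BorelSpace E]
  [SecondCountableTopology E] [CompleteSpace E]

/-- Adding an independent centered vector bounded by `B` to `s`: the effect on the
Gaussian-type moment `exp (a ‖·‖²)`. -/
theorem lintegral_exp_norm_add_sq_le {W : X → E} (hW : Measurable W) {B : ℝ}
    (hB : ∀ x, ‖W x‖ ≤ B) (h0 : ∫ x, W x ∂μ = 0) {a : ℝ} (ha : 0 ≤ a) (s : E) :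
    ∫⁻ x, ENNReal.ofReal (Real.exp (a * ‖W x + s‖ ^ 2)) ∂μ ≤
      ENNReal.ofReal (Real.exp (a * B ^ 2)) *
        ENNReal.ofReal (Real.exp (a * (1 + 2 * (a * B ^ 2)) * ‖s‖ ^ 2)) := by
  have hWi : Integrable W μ :=
    Integrable.of_bound hW.aestronglyMeasurable B (Filter.Eventually.of_forall hB)
  have hB0 : 0 ≤ B := by
    obtain ⟨x⟩ : Nonempty X := nonempty_of_isProbabilityMeasure μ
    exact (norm_nonneg _).trans (hB x)
  have hsub : ProbabilityTheory.HasSubgaussianMGF (fun x => inner ℝ s (W x))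
      ((‖‖s‖ * B - -(‖s‖ * B)‖₊ / 2) ^ 2) μ := by
    refine ProbabilityTheory.hasSubgaussianMGF_of_mem_Icc_of_integral_eq_zero
      (by fun_prop) (Filter.Eventually.of_forall fun x => ?_) ?_
    · rw [Set.mem_Icc, ← abs_le]
      exact (abs_real_inner_le_norm _ _).trans
        (mul_le_mul_of_nonneg_left (hB x) (norm_nonneg _))
    · rw [integral_inner hWi, h0, inner_zero_right]
  have hInt := hsub.integrable_exp_mul (2 * a)
  have hmgf := hsub.mgf_le (2 * a)
  have hc : (((‖‖s‖ * B - -(‖s‖ * B)‖₊ / 2) ^ 2 : NNReal) : ℝ) = (‖s‖ * B) ^ 2 := by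
    push_cast
    rw [Real.norm_eq_abs, sub_neg_eq_add, abs_of_nonneg (by positivity)]
    ring
  rw [hc, ProbabilityTheory.mgf] at hmgf
  calc ∫⁻ x, ENNReal.ofReal (Real.exp (a * ‖W x + s‖ ^ 2)) ∂μ
      ≤ ∫⁻ x, ENNReal.ofReal (Real.exp (a * B ^ 2 + a * ‖s‖ ^ 2)) *
          ENNReal.ofReal (Real.exp (2 * a * inner ℝ s (W x))) ∂μ := by
        refine lintegral_mono fun x => ?_
        rw [← ENNReal.ofReal_mul (Real.exp_nonneg _), ← Real.exp_add]
        refine ENNReal.ofReal_le_ofReal (Real.exp_le_exp.2 ?_)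
        rw [norm_add_sq_real, real_inner_comm]
        have := pow_le_pow_left₀ (norm_nonneg _) (hB x) 2
        nlinarith [mul_le_mul_of_nonneg_left this ha]
    _ = ENNReal.ofReal (Real.exp (a * B ^ 2 + a * ‖s‖ ^ 2)) *
          ENNReal.ofReal (∫ x, Real.exp (2 * a * inner ℝ s (W x)) ∂μ) := by
        rw [lintegral_const_mul _ (by fun_prop), ofReal_integral_eq_lintegral_ofReal hInt
          (Filter.Eventually.of_forall fun _ => Real.exp_nonneg _)]
    _ ≤ ENNReal.ofReal (Real.exp (a * B ^ 2 + a * ‖s‖ ^ 2)) *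
          ENNReal.ofReal (Real.exp ((‖s‖ * B) ^ 2 * (2 * a) ^ 2 / 2)) := by
        gcongr
    _ = _ := by
        rw [← ENNReal.ofReal_mul (Real.exp_nonneg _), ← ENNReal.ofReal_mul (Real.exp_nonneg _),
          ← Real.exp_add, ← Real.exp_add]
        congr 2
        ring

/-- Dimension-free bound on the Gaussian-type moment of a sum of i.i.d. centered bounded vectors. -/
theorem lintegral_exp_norm_sum_sq_le {W : X → E} (hW : Measurable W) {B : ℝ}
    (hB : ∀ x, ‖W x‖ ≤ B) (h0 : ∫ x, W x ∂μ = 0) (n : ℕ) {a : ℝ} (ha : 0 ≤ a)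
    (han : 2 * n * (a * B ^ 2) < 1) :
    ∫⁻ q, ENNReal.ofReal (Real.exp (a * ‖∑ r, W (q r)‖ ^ 2)) ∂(Measure.pi fun _ : Fin n => μ) ≤
      ENNReal.ofReal (Real.exp (n * (a * B ^ 2 / (1 - 2 * n * (a * B ^ 2))))) := by
  induction n generalizing a with
  | zero => simp
  | succ n ih =>
    set b := a * B ^ 2 with hb
    have hb0 : 0 ≤ b := by positivity
    push_cast at han
    have hn0 : (0 : ℝ) ≤ n := n.cast_nonneg
    have hn1 : 2 * n * b < 1 := by nlinarith
    have hb' : a * (1 + 2 * b) * B ^ 2 = b * (1 + 2 * b) := by rw [hb]; ring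
    have han' : 2 * n * (b * (1 + 2 * b)) < 1 := by nlinarith
    have hIH := ih (a := a * (1 + 2 * b)) (by positivity) (by rwa [hb'])
    rw [hb'] at hIH
    have hmp := measurePreserving_piFinSuccAbove (fun _ : Fin (n + 1) => μ) 0
    have hmeas : Measurable fun z : X × (Fin n → X) =>
        ENNReal.ofReal (Real.exp (a * ‖W z.1 + ∑ r, W (z.2 r)‖ ^ 2)) := by
      fun_prop
    have hsplit := hmp.lintegral_comp hmeas
    calc ∫⁻ q, ENNReal.ofReal (Real.exp (a * ‖∑ r, W (q r)‖ ^ 2))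
          ∂(Measure.pi fun _ : Fin (n + 1) => μ)
        = ∫⁻ z : X × (Fin n → X),
            ENNReal.ofReal (Real.exp (a * ‖W z.1 + ∑ r, W (z.2 r)‖ ^ 2))
              ∂(μ.prod (Measure.pi fun _ : Fin n => μ)) := by
          rw [← hsplit]
          refine lintegral_congr fun q => ?_
          rw [Fin.sum_univ_succAbove _ 0]
          rfl
      _ = ∫⁻ y : Fin n → X, ∫⁻ x,
            ENNReal.ofReal (Real.exp (a * ‖W x + ∑ r, W (y r)‖ ^ 2)) ∂μ
              ∂(Measure.pi fun _ : Fin n => μ) := lintegral_prod_symm _ hmeas.aemeasurable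
      _ ≤ ∫⁻ y : Fin n → X, ENNReal.ofReal (Real.exp b) *
            ENNReal.ofReal (Real.exp (a * (1 + 2 * b) * ‖∑ r, W (y r)‖ ^ 2))
              ∂(Measure.pi fun _ : Fin n => μ) :=
          lintegral_mono fun y => lintegral_exp_norm_add_sq_le hW hB h0 ha _
      _ ≤ ENNReal.ofReal (Real.exp b) * ENNReal.ofReal
            (Real.exp (n * (b * (1 + 2 * b) / (1 - 2 * n * (b * (1 + 2 * b)))))) := by
          rw [lintegral_const_mul _ (by fun_prop)]
          gcongr
      _ ≤ _ := by
          rw [← ENNReal.ofReal_mul (Real.exp_nonneg _), ← Real.exp_add]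
          refine ENNReal.ofReal_le_ofReal (Real.exp_le_exp.2 ?_)
          push_cast
          have hd : 0 < 1 - 2 * (n + 1) * b := by linarith
          have h1 : b ≤ b / (1 - 2 * (n + 1) * b) := by
            rw [le_div_iff₀ hd]
            nlinarith [mul_nonneg hb0 (mul_nonneg (by positivity : 0 ≤ 2 * ((n : ℝ) + 1)) hb0)]
          have h2 : b * (1 + 2 * b) / (1 - 2 * n * (b * (1 + 2 * b))) ≤
              b / (1 - 2 * (n + 1) * b) := by
            rw [div_le_div_iff₀ (by linarith) hd, mul_assoc]
            refine mul_le_mul_of_nonneg_left ?_ hb0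
            nlinarith [sq_nonneg b]
          nlinarith [mul_le_mul_of_nonneg_left h2 hn0]

/-- Hoeffding's inequality for sums of i.i.d. centered bounded vectors in a Hilbert space. -/
theorem measure_norm_sum_le_ge {W : X → E} (hW : Measurable W) {B : ℝ} (hBpos : 0 < B)
    (hB : ∀ x, ‖W x‖ ≤ B) (h0 : ∫ x, W x ∂μ = 0) {m : ℕ} (hm : 0 < m) {δ : ℝ} (hδ : 0 < δ)
    (hδ1 : δ < 1) :
    ENNReal.ofReal (1 - δ) ≤ (Measure.pi fun _ : Fin m => μ)
      {q | ‖∑ r, W (q r)‖ ^ 2 ≤ 4 * m * B ^ 2 * Real.log (2 / δ)} := by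
  have hm0 : (0 : ℝ) < m := Nat.cast_pos.2 hm
  set a : ℝ := (4 * m * B ^ 2)⁻¹ with ha
  have hb : a * B ^ 2 = (4 * m : ℝ)⁻¹ := by rw [ha]; field_simp
  have hmom := lintegral_exp_norm_sum_sq_le (μ := μ) hW hB h0 m (a := a) (by positivity)
    (by rw [hb, ← div_eq_mul_inv, div_lt_one (by positivity)]; linarith)
  have hexp : Real.exp (m * (a * B ^ 2 / (1 - 2 * m * (a * B ^ 2)))) ≤ 2 := by
    have : (m : ℝ) * (a * B ^ 2 / (1 - 2 * m * (a * B ^ 2))) = 1 / 2 := by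
      rw [hb, show 2 * (m : ℝ) * (4 * m : ℝ)⁻¹ = 1 / 2 by field_simp; norm_num]
      field_simp
      norm_num
    rw [this, ← Real.le_log_iff_exp_le (by norm_num)]
    linarith [Real.log_two_gt_d9]
  set A := {q : Fin m → X | ‖∑ r, W (q r)‖ ^ 2 ≤ 4 * m * B ^ 2 * Real.log (2 / δ)} with hA
  have hAm : MeasurableSet A := measurableSet_le (by fun_prop) (by fun_prop)
  have hAc : (Measure.pi fun _ : Fin m => μ) Aᶜ ≤ ENNReal.ofReal δ := by
    have hmark := mul_meas_ge_le_lintegral (μ := Measure.pi fun _ : Fin m => μ)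
      (f := fun q => ENNReal.ofReal (Real.exp (a * ‖∑ r, W (q r)‖ ^ 2))) (by fun_prop)
      (ENNReal.ofReal (2 / δ))
    have hsub : Aᶜ ⊆ {q : Fin m → X | ENNReal.ofReal (2 / δ) ≤
        ENNReal.ofReal (Real.exp (a * ‖∑ r, W (q r)‖ ^ 2))} := by
      intro q hq
      simp only [hA, Set.mem_compl_iff, Set.mem_ofPred_eq, not_le] at hq ⊢
      refine ENNReal.ofReal_le_ofReal ?_
      rw [← Real.log_le_iff_le_exp (by positivity), ha, inv_mul_eq_div,
        le_div_iff₀ (by positivity)]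
      linarith
    have h2 : ENNReal.ofReal (2 / δ) * (Measure.pi fun _ : Fin m => μ) Aᶜ ≤
        ENNReal.ofReal (2 / δ) * ENNReal.ofReal δ := by
      rw [← ENNReal.ofReal_mul (by positivity), div_mul_cancel₀ _ hδ.ne']
      exact (mul_le_mul_right (measure_mono hsub) _).trans
        (hmark.trans (hmom.trans (ENNReal.ofReal_le_ofReal hexp)))
    exact (ENNReal.mul_le_mul_iff_right (by simp [hδ]) ENNReal.ofReal_ne_top).1 h2
  rw [ENNReal.ofReal_sub _ hδ.le, ENNReal.ofReal_one, tsub_le_iff_right,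
    ← prob_add_prob_compl hAm (μ := Measure.pi fun _ : Fin m => μ)]
  gcongr

end HilbertConcentration

section Features

variable {X : Type*} {L : ℕ} {N : Fin (L + 1) → ℕ}

/-- The feature vector with coordinates `N_ℓ^{-1/4} Y_{ℓ,j}(x)`. -/
noncomputable def chanFeature (Y : ((ℓ : Fin (L + 1)) × Fin (N ℓ)) → X → ℝ) (x : X) :
    EuclideanSpace ℝ ((ℓ : Fin (L + 1)) × Fin (N ℓ)) :=
  WithLp.toLp 2 fun p => Real.sqrt (Real.sqrt (N p.1))⁻¹ * Y p x

variable {Y : ((ℓ : Fin (L + 1)) × Fin (N ℓ)) → X → ℝ}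

theorem measurable_chanFeature [MeasurableSpace X] (hY : ∀ p, Measurable (Y p)) :
    Measurable (chanFeature Y) :=
  (WithLp.measurable_toLp _ _).comp (measurable_pi_lambda _ fun p => (hY p).const_mul _)

theorem chanAct_eq_sum (x x' : X) :
    chanAct Y x x' = ∑ p, (Real.sqrt (N p.1))⁻¹ * (Y p x * Y p x') := by
  simp only [chanAct, Fintype.sum_sigma, Finset.mul_sum]

theorem chanKer_eq_sum (x x' : X) :
    chanKer Y x x' = ∑ p, ((N p.1 : ℝ))⁻¹ * (Y p x * Y p x') := by
  simp only [chanKer, Fintype.sum_sigma, Finset.mul_sum]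

theorem inner_chanFeature (x x' : X) :
    inner ℝ (chanFeature Y x) (chanFeature Y x') = chanAct Y x x' := by
  rw [chanAct_eq_sum, PiLp.inner_apply]
  refine Finset.sum_congr rfl fun p _ => ?_
  have := Real.mul_self_sqrt (inv_nonneg.2 (Real.sqrt_nonneg (N p.1)))
  simp only [chanFeature, RCLike.inner_apply, conj_trivial]
  linear_combination (Y p x * Y p x') * this

theorem norm_chanFeature_sq
    (hadd : ∀ (ℓ : Fin (L + 1)) (x : X), ∑ j : Fin (N ℓ), Y ⟨ℓ, j⟩ x ^ 2 = N ℓ) (x : X) :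
    ‖chanFeature Y x‖ ^ 2 = ∑ ℓ, Real.sqrt (N ℓ) := by
  rw [← real_inner_self_eq_norm_sq, inner_chanFeature, chanAct]
  refine Finset.sum_congr rfl fun ℓ _ => ?_
  simp only [← sq, hadd]
  rw [inv_mul_eq_div, Real.div_sqrt]

theorem integral_chanAct_mul_chanAct [MeasurableSpace X] {μ : Measure X}
    (hY : ∀ p, Measurable (Y p))
    (horth : ∀ p q, ∫ x, Y p x * Y q x ∂μ = if p = q then 1 else 0) (x x' : X) :
    ∫ q, chanAct Y x q * chanAct Y q x' ∂μ = chanKer Y x x' := by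
  have hL2 : ∀ p, MemLp (Y p) 2 μ := fun p => by
    refine (memLp_two_iff_integrable_sq (hY p).aestronglyMeasurable).2 ?_
    by_contra h
    have h1 := horth p p
    simp only [← sq, integral_undef h, if_true] at h1
    exact zero_ne_one h1
  have hInt : ∀ p q, Integrable (fun y => Y p y * Y q y) μ := fun p q =>
    (hL2 p).integrable_mul (hL2 q)
  have hprod : ∀ y, chanAct Y x y * chanAct Y y x' = ∑ p, ∑ p',
      ((Real.sqrt (N p.1))⁻¹ * Y p x * ((Real.sqrt (N p'.1))⁻¹ * Y p' x')) *
        (Y p y * Y p' y) := fun y => by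
    rw [chanAct_eq_sum, chanAct_eq_sum, Finset.sum_mul_sum]
    refine Finset.sum_congr rfl fun p _ => Finset.sum_congr rfl fun p' _ => ?_
    ring
  simp only [hprod]
  rw [integral_finsetSum _ fun p _ => integrable_finsetSum _ fun p' _ =>
    (hInt p p').const_mul _, chanKer_eq_sum]
  refine Finset.sum_congr rfl fun p _ => ?_
  rw [integral_finsetSum _ fun p' _ => (hInt p p').const_mul _]
  simp only [integral_const_mul, horth, mul_ite, mul_one, mul_zero, Finset.sum_ite_eq,
    Finset.mem_univ, if_true]
  have : (Real.sqrt (N p.1))⁻¹ * (Real.sqrt (N p.1))⁻¹ = ((N p.1 : ℝ))⁻¹ := by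
    rw [← mul_inv, Real.mul_self_sqrt (Nat.cast_nonneg _)]
  linear_combination (Y p x * Y p x') * this

end Features

/-- In the orthonormal-family setup with groups `ℓ = 0,…,ℓ̂`, activation `σ` and kernel `K`,
with `S := Σ_ℓ √N_ℓ` and empirical kernel `K̂(x,x') := (1/m) Σ_r σ(x,q_r) σ(q_r,x')` built from
i.i.d. samples `q₁,…,q_m ∼ μ`, there is an absolute constant `C > 0` such that for every fixed
`x' ∈ X` and every `δ ∈ (0,1)`, with probability at least `1 − δ` over the sample:
`sup_{x∈X} |K̂(x,x') − K(x,x')| ≤ C S² √(log(2/δ)/m)`. -/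
theorem empirical_kernel_uniform_concentration :
    ∃ C > (0 : ℝ),
      ∀ (X : Type) (_ : MeasurableSpace X) (μ : Measure X), IsProbabilityMeasure μ →
      ∀ (L : ℕ) (N : Fin (L + 1) → ℕ), (∀ ℓ, 1 ≤ N ℓ) →
      ∀ Y : ((ℓ : Fin (L + 1)) × Fin (N ℓ)) → X → ℝ,
        (∀ p, Measurable (Y p)) →
        (∀ p q, ∫ x, Y p x * Y q x ∂μ = if p = q then 1 else 0) →
        (∀ (ℓ : Fin (L + 1)) (x : X), ∑ j : Fin (N ℓ), Y ⟨ℓ, j⟩ x ^ 2 = N ℓ) →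
      ∀ m : ℕ, 0 < m → ∀ (x' : X) (δ : ℝ), 0 < δ → δ < 1 →
        (Measure.pi fun _ : Fin m => μ)
            {q : Fin m → X | ∀ x : X,
              |(m : ℝ)⁻¹ * ∑ r : Fin m, chanAct Y x (q r) * chanAct Y (q r) x' -
                  chanKer Y x x'| ≤
                C * (∑ ℓ : Fin (L + 1), Real.sqrt (N ℓ)) ^ 2 *
                  Real.sqrt (Real.log (2 / δ) / m)} ≥
          ENNReal.ofReal (1 - δ) := by
  refine ⟨4, by norm_num, ?_⟩
  intro X _ μ _ L N hN Y hY horth hadd m hm x' δ hδ hδ1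
  set S := ∑ ℓ : Fin (L + 1), Real.sqrt (N ℓ) with hS
  have hSpos : 0 < S := Finset.sum_pos
    (fun ℓ _ => Real.sqrt_pos.2 (Nat.cast_pos.2 (hN ℓ))) Finset.univ_nonempty
  have hφ : ∀ x, ‖chanFeature Y x‖ = Real.sqrt S := fun x => by
    rw [hS, ← norm_chanFeature_sq hadd x, Real.sqrt_sq (norm_nonneg _)]
  have hact : ∀ x y, |chanAct Y x y| ≤ S := fun x y => by
    rw [← inner_chanFeature]
    refine (abs_real_inner_le_norm _ _).trans_eq ?_
    rw [hφ, hφ, Real.mul_self_sqrt hSpos.le]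
  have hactm : Measurable fun q => chanAct Y q x' := by
    simp only [chanAct_eq_sum]
    fun_prop
  set V : X → EuclideanSpace ℝ ((ℓ : Fin (L + 1)) × Fin (N ℓ)) :=
    fun q => chanAct Y q x' • chanFeature Y q with hV
  have hVm : Measurable V := hactm.smul (measurable_chanFeature hY)
  have hVb : ∀ q, ‖V q‖ ≤ S * Real.sqrt S := fun q => by
    rw [hV, norm_smul, hφ, Real.norm_eq_abs]
    exact mul_le_mul_of_nonneg_right (hact _ _) (Real.sqrt_nonneg _)
  have hVi : Integrable V μ :=
    Integrable.of_bound hVm.aestronglyMeasurable _ (Filter.Eventually.of_forall hVb)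
  have hEV : ‖∫ y, V y ∂μ‖ ≤ S * Real.sqrt S := by
    simpa using norm_integral_le_of_norm_le_const (Filter.Eventually.of_forall hVb) (μ := μ)
  have hinner : ∀ x q, inner ℝ (chanFeature Y x) (V q) = chanAct Y x q * chanAct Y q x' :=
    fun x q => by rw [hV, inner_smul_right, inner_chanFeature, mul_comm]
  have hker : ∀ x, inner ℝ (chanFeature Y x) (∫ y, V y ∂μ) = chanKer Y x x' := fun x => by
    rw [← integral_inner hVi, ← integral_chanAct_mul_chanAct hY horth]
    simp only [hinner]
  have hconc := measure_norm_sum_le_ge (μ := μ) (W := fun q => V q - ∫ y, V y ∂μ)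
    (hVm.sub_const _) (B := 2 * (S * Real.sqrt S)) (by positivity)
    (fun q => (norm_sub_le _ _).trans (by linarith [hVb q]))
    (by rw [integral_sub hVi (integrable_const _)]; simp) hm hδ hδ1
  refine hconc.trans (measure_mono fun q hq x => ?_)
  simp only [Set.mem_ofPred_eq] at hq
  have hm0 : (0 : ℝ) < m := Nat.cast_pos.2 hm
  have hlog : 0 ≤ Real.log (2 / δ) := Real.log_nonneg (by rw [le_div_iff₀ hδ]; linarith)
  have hid : (m : ℝ)⁻¹ * ∑ r, chanAct Y x (q r) * chanAct Y (q r) x' - chanKer Y x x' =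
      (m : ℝ)⁻¹ * inner ℝ (chanFeature Y x) (∑ r, (V (q r) - ∫ y, V y ∂μ)) := by
    rw [inner_sum]
    simp only [inner_sub_right, hinner, hker, Finset.sum_sub_distrib,
      Finset.sum_const, Finset.card_univ, Fintype.card_fin, nsmul_eq_mul]
    field_simp
  have hSS : Real.sqrt S ^ 2 = S := Real.sq_sqrt hSpos.le
  have hnorm : ‖∑ r, (V (q r) - ∫ y, V y ∂μ)‖ ≤
      4 * m * (S * Real.sqrt S) * Real.sqrt (Real.log (2 / δ) / m) := by
    refine abs_le_of_sq_le_sq' (hq.trans_eq ?_) (by positivity) |>.2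
    rw [mul_pow _ (Real.sqrt (_ / _)), Real.sq_sqrt (by positivity)]
    field_simp
    ring
  rw [hid, abs_mul, abs_of_pos (inv_pos.2 hm0)]
  calc (m : ℝ)⁻¹ * |inner ℝ (chanFeature Y x) (∑ r, (V (q r) - ∫ y, V y ∂μ))|
      ≤ (m : ℝ)⁻¹ * (Real.sqrt S *
          (4 * m * (S * Real.sqrt S) * Real.sqrt (Real.log (2 / δ) / m))) := by
        gcongr
        refine (abs_real_inner_le_norm _ _).trans ?_
        rw [hφ]
        gcongr
    _ = 4 * S * Real.sqrt S ^ 2 * Real.sqrt (Real.log (2 / δ) / m) := by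
        field_simp
    _ = 4 * S ^ 2 * Real.sqrt (Real.log (2 / δ) / m) := by
        rw [hSS]
        ring
end
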